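/- arXiv:0710.3928 — 3 statements merged into one kernel-verified Lean document; each statement's English description precedes it below -/
import Mathlib

section
/- There exist constants C0 > 0 and c > 0 such that for every δ > 0 there is N such that for every n ≥ N divisible by 3 and every p with n·p ≥ C0, with probability at least 1 − δ a sample G ~ 𝒢_{n,p,3} admits an (n·p)-core D ⊆ V with |D| ≥ (1 − e^{−c·n·p})·n. -/
open MeasureTheory

/-- The balanced planted 3-coloring on `Fin n`: vertex `v` gets color `v mod 3`. -/
def plantedColoring (n : ℕ) (v : Fin n) : Fin 3 := ⟨v.val % 3, Nat.mod_lt _ (by norm_num)⟩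

/-- A pair of vertices is bichromatic if its two endpoints get distinct planted colors. -/
def Bichrom (n : ℕ) (e : Sym2 (Fin n)) : Prop :=
  Sym2.lift ⟨fun u v => plantedColoring n u ≠ plantedColoring n v,
    fun u v => propext ne_comm⟩ e

/-- The type of bichromatic pairs. -/
abbrev BichromPair (n : ℕ) : Type := {e : Sym2 (Fin n) // Bichrom n e}

noncomputable instance (n : ℕ) : Fintype (BichromPair n) := Fintype.ofFinite _

/-- The Bernoulli measure on `Bool` with parameter `p`. -/
noncomputable def bernoulliMeasure (p : ℝ) : Measure Bool :=
  ENNReal.ofReal p • Measure.dirac true + ENNReal.ofReal (1 - p) • Measure.dirac false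

/-- The planted 3-coloring distribution `𝒢_{n,p,3}`: the product over all bichromatic
pairs of Bernoulli(p) measures on `Bool`. -/
noncomputable def plantedMeasure (n : ℕ) (p : ℝ) : Measure (BichromPair n → Bool) :=
  Measure.pi fun _ => bernoulliMeasure p

/-- The graph of a sample point `ω`: its edges are the bichromatic pairs `e` with
`ω e = true`. -/
def plantedGraph (n : ℕ) (ω : BichromPair n → Bool) : SimpleGraph (Fin n) :=
  SimpleGraph.fromEdgeSet {e : Sym2 (Fin n) | ∃ h : Bichrom n e, ω ⟨e, h⟩ = true}

/-- `e(S)`: the number of edges of `G` with both endpoints in `S`. -/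
noncomputable def edgeCount {V : Type*} (G : SimpleGraph V) (S : Set V) : ℕ :=
  {e : Sym2 V | e ∈ G.edgeSet ∧ ∀ v ∈ e, v ∈ S}.ncard

/-- `D` is a `d`-core: every `v ∈ D` has at least `d/5` neighbors in `D ∩ V_i` for
each color class index `i ≠ φ*(v)`, and at most `d/20` neighbors outside `D`. -/
def IsCore (n : ℕ) (G : SimpleGraph (Fin n)) (d : ℝ) (D : Set (Fin n)) : Prop :=
  ∀ v ∈ D,
    (∀ i : Fin 3, i ≠ plantedColoring n v →
      d / 5 ≤ ({w : Fin n | G.Adj v w ∧ w ∈ D ∧ plantedColoring n w = i}.ncard : ℝ)) ∧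
    ({w : Fin n | G.Adj v w ∧ w ∉ D}.ncard : ℝ) ≤ d / 20

/-- `c_t(u,v,m)`: the number of neighbors `w` of `u` other than `v` with `m(w→u) = some t`. -/
noncomputable def msgCount {V : Type*} (G : SimpleGraph V)
    (m : V → V → Option (Fin 3)) (u v : V) (t : Fin 3) : ℕ :=
  {w : V | G.Adj u w ∧ w ≠ v ∧ m w u = some t}.ncard

/-- The smallest color minimizing `f`. -/
def argminFin3 (f : Fin 3 → ℕ) : Fin 3 :=
  if f 0 ≤ f 1 ∧ f 0 ≤ f 2 then 0 else if f 1 ≤ f 2 then 1 else 2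

open Classical in
/-- Gallager update (threshold τ = 1): `U(m)(u→v) = none` if at least two distinct colors
have count 0, otherwise the smallest color minimizing the count. -/
noncomputable def gallagerUpdate {V : Type*} (G : SimpleGraph V)
    (m : V → V → Option (Fin 3)) : V → V → Option (Fin 3) := fun u v =>
  if ∃ t₁ t₂ : Fin 3, t₁ ≠ t₂ ∧ msgCount G m u v t₁ = 0 ∧ msgCount G m u v t₂ = 0 then none
  else some (argminFin3 (msgCount G m u v))

/-- The number of neighbors `w` of `u` with `m(w→u) = some t`. -/
noncomputable def outCount {V : Type*} (G : SimpleGraph V)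
    (m : V → V → Option (Fin 3)) (u : V) (t : Fin 3) : ℕ :=
  {w : V | G.Adj u w ∧ m w u = some t}.ncard

open Classical in
/-- Output `B(u, m)` of a message state at a vertex `u`. -/
noncomputable def gallagerOutput {V : Type*} (G : SimpleGraph V)
    (m : V → V → Option (Fin 3)) (u : V) : Option (Fin 3) :=
  if ∃ t₁ t₂ : Fin 3, t₁ ≠ t₂ ∧ outCount G m u t₁ = 0 ∧ outCount G m u t₂ = 0 then none
  else some (argminFin3 (outCount G m u))

/-- The Gallager iterates: `m⁰(u→v) = some (φ u)`, `mⁱ⁺¹ = U(mⁱ)`. -/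
noncomputable def gallagerIter {V : Type*} (G : SimpleGraph V) (φ : V → Fin 3) :
    ℕ → V → V → Option (Fin 3)
  | 0 => fun u _ => some (φ u)
  | i + 1 => gallagerUpdate G (gallagerIter G φ i)

lemma isProbabilityMeasure_bernoulliMeasure {p : ℝ} (h0 : 0 ≤ p) (h1 : p ≤ 1) :
    IsProbabilityMeasure (bernoulliMeasure p) := by
  constructor
  simp [bernoulliMeasure, ← ENNReal.ofReal_add h0 (sub_nonneg.2 h1)]

lemma isProbabilityMeasure_plantedMeasure (n : ℕ) {p : ℝ} (h0 : 0 ≤ p) (h1 : p ≤ 1) :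
    IsProbabilityMeasure (plantedMeasure n p) := by
  have := isProbabilityMeasure_bernoulliMeasure h0 h1
  unfold plantedMeasure
  infer_instance

lemma integral_bernoulliMeasure {p : ℝ} (h0 : 0 ≤ p) (h1 : p ≤ 1) (f : Bool → ℝ) :
    ∫ b, f b ∂bernoulliMeasure p = p * f true + (1 - p) * f false := by
  have h1' := sub_nonneg.2 h1
  rw [bernoulliMeasure, integral_add_measure, integral_smul_measure, integral_smul_measure]
  · simp [ENNReal.toReal_ofReal, h0, h1']
  · exact (integrable_dirac (by simp)).smul_measure ENNReal.ofReal_ne_top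
  · exact (integrable_dirac (by simp)).smul_measure ENNReal.ofReal_ne_top

/-- Chernoff bound for a weighted sum of the edge indicators. -/
lemma plantedMeasure_weighted_sum_ge_le (n : ℕ) {p : ℝ} (h0 : 0 ≤ p) (h1 : p ≤ 1)
    (t : BichromPair n → ℝ) (a : ℝ) :
    plantedMeasure n p {ω | a ≤ ∑ e, if ω e = true then t e else 0} ≤
      ENNReal.ofReal (Real.exp (-a + p * ∑ e, (Real.exp (t e) - 1))) := by
  have := isProbabilityMeasure_bernoulliMeasure h0 h1
  have := isProbabilityMeasure_plantedMeasure n h0 h1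
  have key := ProbabilityTheory.measure_ge_le_exp_mul_mgf (μ := plantedMeasure n p)
    (X := fun ω => ∑ e, if ω e = true then t e else 0) a zero_le_one Integrable.of_finite
  have hmgf : ProbabilityTheory.mgf (fun ω => ∑ e, if ω e = true then t e else 0)
      (plantedMeasure n p) 1 ≤ Real.exp (p * ∑ e, (Real.exp (t e) - 1)) := by
    simp only [ProbabilityTheory.mgf, one_mul, Real.exp_sum, plantedMeasure]
    rw [integral_fintype_prod_eq_prod (fun e b => Real.exp (if b = true then t e else 0)),
      Finset.mul_sum, Real.exp_sum]
    refine Finset.prod_le_prod (fun _ _ => integral_nonneg fun _ => (Real.exp_pos _).le)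
      fun e _ => ?_
    rw [integral_bernoulliMeasure h0 h1]
    have := Real.add_one_le_exp (p * (Real.exp (t e) - 1))
    simp only [if_true, Bool.false_eq_true, if_false, Real.exp_zero]
    linarith
  rw [← ofReal_measureReal]
  refine ENNReal.ofReal_le_ofReal (key.trans ?_)
  rw [Real.exp_add, neg_one_mul]
  gcongr
/-- A set `S` with a labelling `i` certifying that `S` is hard to separate from the core: every
`v ∈ S` whose label differs from its own color has few neighbors of color `i v`, and the remaining
vertices of `S` account for at least `d / 20` edges inside `S` each. -/
def IsObstruction (n : ℕ) (G : SimpleGraph (Fin n)) (d : ℝ) (S : Finset (Fin n))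
    (i : Fin n → Fin 3) : Prop :=
  (∀ v ∈ S, i v ≠ plantedColoring n v →
    ({w : Fin n | G.Adj v w ∧ plantedColoring n w = i v}.ncard : ℝ) < d / 4) ∧
  ((S.filter fun v => i v = plantedColoring n v).card : ℝ) * (d / 20) ≤ edgeCount G (S : Set (Fin n))

lemma edgeCount_insert {V : Type*} [Finite V] (G : SimpleGraph V) {S : Set V} {v : V}
    (hv : v ∉ S) :
    edgeCount G S + {w : V | G.Adj v w ∧ w ∈ S}.ncard ≤ edgeCount G (insert v S) := by
  have hinj : Set.InjOn (fun w => s(v, w)) {w : V | G.Adj v w ∧ w ∈ S} := by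
    intro a _ b _ hab
    exact Sym2.congr_right.1 hab
  unfold edgeCount
  rw [← hinj.ncard_image, ← Set.ncard_union_eq]
  · refine Set.ncard_le_ncard ?_ (Set.toFinite _)
    rintro e (⟨he, heS⟩ | ⟨w, ⟨hw, hwS⟩, rfl⟩)
    · exact ⟨he, fun x hx => Or.inr (heS x hx)⟩
    · refine ⟨hw, fun x hx => ?_⟩
      rcases Sym2.mem_iff.1 hx with rfl | rfl
      · exact Or.inl rfl
      · exact Or.inr hwS
  · rw [Set.disjoint_left]
    rintro e ⟨_, he⟩ ⟨w, _, rfl⟩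
    exact hv (he v (Sym2.mem_mk_left v w))

lemma IsObstruction.exists_insert {n : ℕ} {G : SimpleGraph (Fin n)} {d : ℝ} {S : Finset (Fin n)}
    {i : Fin n → Fin 3} (hS : IsObstruction n G d S i)
    (hcore : ¬ IsCore n G d (S : Set (Fin n))ᶜ) :
    ∃ v ∉ S, ∃ c : Fin 3, IsObstruction n G d (insert v S) (Function.update i v c) := by
  simp only [IsCore, not_forall] at hcore
  obtain ⟨v, hv, hcore⟩ := hcore
  have hvS : v ∉ S := by simpa using hv
  have hne : ∀ w ∈ S, w ≠ v := fun w hw h => hvS (h ▸ hw)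
  have hedge := edgeCount_insert G (S := (S : Set (Fin n))) (v := v) (by simpa using hvS)
  have hedge' : (edgeCount G (S : Set (Fin n)) : ℝ) +
      ({w : Fin n | G.Adj v w ∧ w ∈ (S : Set (Fin n))}.ncard : ℝ) ≤
      edgeCount G (insert v (S : Set (Fin n))) := by exact_mod_cast hedge
  have hfilter (c : Fin 3) : (S.filter fun w => Function.update i v c w = plantedColoring n w) =
      S.filter fun w => i w = plantedColoring n w :=
    Finset.filter_congr fun w hw => by rw [Function.update_of_ne (hne w hw)]
  refine ⟨v, hvS, ?_⟩
  by_cases hout : ({w : Fin n | G.Adj v w ∧ w ∈ (S : Set (Fin n))}.ncard : ℝ) ≤ d / 20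
  · have hdeg : ∃ c ≠ plantedColoring n v, ({w : Fin n | G.Adj v w ∧ w ∈ (S : Set (Fin n))ᶜ ∧
        plantedColoring n w = c}.ncard : ℝ) < d / 5 := by
      by_contra! h
      exact hcore ⟨h, by simpa using hout⟩
    obtain ⟨c, hc, hcd⟩ := hdeg
    refine ⟨c, fun w hw hwc => ?_, ?_⟩
    · rcases Finset.mem_insert.1 hw with rfl | hw
      · rw [Function.update_self]
        have hsub : {x : Fin n | G.Adj w x ∧ plantedColoring n x = c} ⊆
            {x : Fin n | G.Adj w x ∧ x ∈ (S : Set (Fin n))ᶜ ∧ plantedColoring n x = c} ∪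
            {x : Fin n | G.Adj w x ∧ x ∈ (S : Set (Fin n))} := by
          rintro x ⟨hx, hxc⟩
          by_cases hxS : x ∈ (S : Set (Fin n))
          · exact Or.inr ⟨hx, hxS⟩
          · exact Or.inl ⟨hx, hxS, hxc⟩
        have hcard := (Set.ncard_le_ncard hsub (Set.toFinite _)).trans (Set.ncard_union_le _ _)
        have hcard' : ({x : Fin n | G.Adj w x ∧ plantedColoring n x = c}.ncard : ℝ) ≤
            ({x : Fin n | G.Adj w x ∧ x ∈ (S : Set (Fin n))ᶜ ∧
              plantedColoring n x = c}.ncard : ℝ) +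
            ({x : Fin n | G.Adj w x ∧ x ∈ (S : Set (Fin n))}.ncard : ℝ) := by exact_mod_cast hcard
        linarith
      · rw [Function.update_of_ne (hne w hw)] at hwc ⊢
        exact hS.1 w hw hwc
    · rw [Finset.filter_insert, Function.update_self, if_neg hc, hfilter, Finset.coe_insert]
      have hnonneg : (0 : ℝ) ≤ ({w : Fin n | G.Adj v w ∧ w ∈ (S : Set (Fin n))}.ncard : ℝ) :=
        Nat.cast_nonneg _
      linarith [hS.2]
  · refine ⟨plantedColoring n v, fun w hw hwc => ?_, ?_⟩
    · rcases Finset.mem_insert.1 hw with rfl | hw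
      · exact absurd (Function.update_self ..) hwc
      · rw [Function.update_of_ne (hne w hw)] at hwc ⊢
        exact hS.1 w hw hwc
    · rw [Finset.filter_insert, Function.update_self, if_pos rfl, hfilter, Finset.coe_insert,
        Finset.card_insert_of_notMem (by simp [hvS]), Nat.cast_add, Nat.cast_one]
      linarith [hS.2]

/-- If no set with complement of size at most `m` is a core, then obstructions of all sizes up to
`m + 1` exist. -/
lemma exists_isObstruction {n : ℕ} {G : SimpleGraph (Fin n)} {d : ℝ} {m : ℕ}
    (hcore : ∀ S : Finset (Fin n), S.card ≤ m → ¬ IsCore n G d (S : Set (Fin n))ᶜ) :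
    ∀ j ≤ m + 1, ∃ S : Finset (Fin n), ∃ i, S.card = j ∧ IsObstruction n G d S i := by
  intro j
  induction j with
  | zero => exact fun _ => ⟨∅, fun _ => 0, rfl, by simp [IsObstruction]⟩
  | succ j ih =>
    intro hj
    obtain ⟨S, i, hcard, hS⟩ := ih (by omega)
    obtain ⟨v, hv, c, hvc⟩ := hS.exists_insert (hcore S (by omega))
    exact ⟨insert v S, Function.update i v c, by rw [Finset.card_insert_of_notMem hv, hcard], hvc⟩

/-- An obstruction depends on its labelling only through the labels of its vertices. -/
lemma IsObstruction.congr {n : ℕ} {G : SimpleGraph (Fin n)} {d : ℝ} {S : Finset (Fin n)}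
    {i i' : Fin n → Fin 3} (hS : IsObstruction n G d S i) (h : ∀ v ∈ S, i' v = i v) :
    IsObstruction n G d S i' := by
  refine ⟨fun v hv => ?_, ?_⟩
  · rw [h v hv]
    exact hS.1 v hv
  · rw [Finset.filter_congr fun v hv => by rw [h v hv]]
    exact hS.2
lemma bichrom_mk {n : ℕ} {u v : Fin n} :
    Bichrom n s(u, v) ↔ plantedColoring n u ≠ plantedColoring n v := Iff.rfl

lemma plantedGraph_adj {n : ℕ} {ω : BichromPair n → Bool} {u v : Fin n} :
    (plantedGraph n ω).Adj u v ↔ ∃ h : Bichrom n s(u, v), ω ⟨s(u, v), h⟩ = true := by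
  rw [plantedGraph, SimpleGraph.fromEdgeSet_adj]
  refine ⟨fun h => h.1, fun h => ⟨h, ?_⟩⟩
  rintro rfl
  exact bichrom_mk.1 h.1 rfl

lemma card_colorClass {n : ℕ} (hn : 3 ∣ n) (c : Fin 3) :
    ((Finset.univ.filter fun v : Fin n => plantedColoring n v = c).card : ℝ) = n / 3 := by
  obtain ⟨m, rfl⟩ := hn
  have hcard : (Finset.univ.filter fun v : Fin (3 * m) => plantedColoring (3 * m) v = c).card =
      (Finset.univ : Finset (Fin m)).card := by
    symm
    refine Finset.card_bij (fun j _ => ⟨3 * j + c, by omega⟩) (fun j _ => ?_)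
      (fun a _ b _ h => ?_) (fun v hv => ?_)
    · simp only [Finset.mem_filter, Finset.mem_univ, true_and, plantedColoring, Fin.ext_iff]
      omega
    · simp only [Fin.ext_iff] at h ⊢
      omega
    · simp only [Finset.mem_filter, Finset.mem_univ, true_and, plantedColoring, Fin.ext_iff] at hv
      refine ⟨⟨v / 3, by omega⟩, Finset.mem_univ _, ?_⟩
      simp only [Fin.ext_iff]
      omega
  rw [hcard]
  simp

open Classical in
/-- The bichromatic pairs inside `S`. -/
noncomputable def innerPairs (n : ℕ) (S : Finset (Fin n)) : Finset (BichromPair n) :=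
  Finset.univ.filter fun e => ∀ v ∈ e.1, v ∈ S

open Classical in
/-- The pairs joining a vertex `v ∈ S` with a foreign label to a vertex of color `i v`
outside `S`. -/
noncomputable def outerPairs (n : ℕ) (S : Finset (Fin n)) (i : Fin n → Fin 3) :
    Finset (BichromPair n) :=
  Finset.univ.filter fun e => ∃ v ∈ S, i v ≠ plantedColoring n v ∧
    ∃ w ∉ S, plantedColoring n w = i v ∧ e.1 = s(v, w)

lemma disjoint_innerPairs_outerPairs (n : ℕ) (S : Finset (Fin n)) (i : Fin n → Fin 3) :
    Disjoint (innerPairs n S) (outerPairs n S i) := by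
  rw [Finset.disjoint_left]
  intro e he he'
  simp only [innerPairs, outerPairs, Finset.mem_filter, Finset.mem_univ, true_and] at he he'
  obtain ⟨v, -, -, w, hw, -, h⟩ := he'
  exact hw (he w (h ▸ Sym2.mem_mk_right v w))

lemma card_innerPairs_le (n : ℕ) (S : Finset (Fin n)) :
    (innerPairs n S).card ≤ S.card ^ 2 := by
  have hle : (innerPairs n S).card ≤ S.sym2.card :=
    Finset.card_le_card_of_injOn Subtype.val
      (fun e he => by
        simp only [innerPairs, Finset.coe_filter, Finset.mem_univ, true_and, Set.mem_ofPred_eq] at he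
        exact Finset.mem_coe.2 (Finset.mem_sym2_iff.2 he))
      Subtype.val_injective.injOn
  rw [Finset.card_sym2, Nat.choose_two_right, Nat.add_sub_cancel] at hle
  refine hle.trans (Nat.div_le_of_le_mul ?_)
  nlinarith [Nat.le_self_pow two_ne_zero S.card]

lemma le_card_outerPairs {n : ℕ} (hn : 3 ∣ n) (S : Finset (Fin n)) (i : Fin n → Fin 3) :
    ((S.filter fun v => i v ≠ plantedColoring n v).card : ℝ) * (n / 3 - S.card) ≤
      (outerPairs n S i).card := by
  classical
  set T := (S.filter fun v => i v ≠ plantedColoring n v).sigma fun v =>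
    (Finset.univ.filter fun w : Fin n => plantedColoring n w = i v) \ S with hT
  have hTcard : ((S.filter fun v => i v ≠ plantedColoring n v).card : ℝ) * (n / 3 - S.card) ≤
      T.card := by
    rw [hT, Finset.card_sigma, Nat.cast_sum, ← nsmul_eq_mul]
    refine Finset.card_nsmul_le_sum _ _ _ fun v _ => ?_
    rw [← card_colorClass hn (i v), sub_le_iff_le_add]
    have := Finset.le_card_sdiff S
      (Finset.univ.filter fun w : Fin n => plantedColoring n w = i v)
    exact_mod_cast (by omega)
  refine hTcard.trans (Nat.cast_le.2 ?_)
  calc T.card = (T.image fun x => s(x.1, x.2)).card := by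
        refine (Finset.card_image_of_injOn ?_).symm
        rintro ⟨a, b⟩ hab ⟨a', b'⟩ hab' h
        simp only [hT, Finset.coe_sigma, Set.mem_sigma_iff, Finset.mem_coe, Finset.mem_filter,
          Finset.mem_sdiff, Finset.mem_univ, true_and] at hab hab'
        rcases Sym2.eq_iff.1 h with ⟨h1, h2⟩ | ⟨h1, h2⟩
        · dsimp only at h1 h2
          subst h1 h2
          rfl
        · dsimp only at h1 h2
          subst h1
          exact absurd hab.1.1 hab'.2.2
    _ ≤ ((outerPairs n S i).image Subtype.val).card := by
        refine Finset.card_le_card fun e he => ?_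
        obtain ⟨⟨v, w⟩, hvw, rfl⟩ := Finset.mem_image.1 he
        simp only [hT, Finset.mem_sigma, Finset.mem_filter, Finset.mem_sdiff, Finset.mem_univ,
          true_and] at hvw
        have hb : Bichrom n s(v, w) := bichrom_mk.2 (by rw [hvw.2.1]; exact hvw.1.2.symm)
        refine Finset.mem_image.2 ⟨⟨s(v, w), hb⟩, ?_, rfl⟩
        simp only [outerPairs, Finset.mem_filter, Finset.mem_univ, true_and]
        exact ⟨v, hvw.1.1, hvw.1.2, w, hvw.2.2, hvw.2.1, rfl⟩
    _ ≤ (outerPairs n S i).card := Finset.card_image_le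

lemma edgeCount_plantedGraph_le (n : ℕ) (ω : BichromPair n → Bool) (S : Finset (Fin n)) :
    edgeCount (plantedGraph n ω) (S : Set (Fin n)) ≤
      ((innerPairs n S).filter fun e => ω e = true).card := by
  classical
  calc edgeCount (plantedGraph n ω) (S : Set (Fin n))
      ≤ ((((innerPairs n S).filter fun e => ω e = true).image Subtype.val :
          Finset (Sym2 (Fin n))) : Set (Sym2 (Fin n))).ncard := by
        refine Set.ncard_le_ncard ?_ (Set.toFinite _)
        rintro e ⟨he, heS⟩
        induction e with | _ u v
        obtain ⟨hb, hω⟩ := plantedGraph_adj.1 he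
        refine Finset.mem_coe.2 (Finset.mem_image.2 ⟨⟨s(u, v), hb⟩, ?_, rfl⟩)
        simp only [innerPairs, Finset.mem_filter, Finset.mem_univ, true_and]
        exact ⟨heS, hω⟩
    _ ≤ _ := by
        rw [Set.ncard_coe_finset]
        exact Finset.card_image_le

lemma card_filter_outerPairs_le (n : ℕ) (ω : BichromPair n → Bool) (S : Finset (Fin n))
    (i : Fin n → Fin 3) :
    ((outerPairs n S i).filter fun e => ω e = true).card ≤
      ∑ v ∈ S.filter (fun v => i v ≠ plantedColoring n v),
        {w : Fin n | (plantedGraph n ω).Adj v w ∧ plantedColoring n w = i v}.ncard := by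
  classical
  calc ((outerPairs n S i).filter fun e => ω e = true).card
      = (((outerPairs n S i).filter fun e => ω e = true).image Subtype.val).card :=
        (Finset.card_image_of_injective _ Subtype.val_injective).symm
    _ ≤ ((S.filter fun v => i v ≠ plantedColoring n v).biUnion fun v =>
          (Finset.univ.filter fun w : Fin n => (plantedGraph n ω).Adj v w ∧
            plantedColoring n w = i v).image fun w => s(v, w)).card := by
        refine Finset.card_le_card fun e' he' => ?_
        obtain ⟨⟨e, hb⟩, he, rfl⟩ := Finset.mem_image.1 he'
        simp only [outerPairs, Finset.mem_filter, Finset.mem_univ, true_and] at he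
        obtain ⟨⟨v, hv, hiv, w, -, hwc, rfl⟩, hω⟩ := he
        simp only [Finset.mem_biUnion, Finset.mem_image, Finset.mem_filter, Finset.mem_univ,
          true_and]
        exact ⟨v, ⟨hv, hiv⟩, w, ⟨plantedGraph_adj.2 ⟨hb, hω⟩, hwc⟩, rfl⟩
    _ ≤ _ := by
        refine Finset.card_biUnion_le.trans (Finset.sum_le_sum fun v _ => ?_)
        refine Finset.card_image_le.trans (le_of_eq ?_)
        rw [← Set.ncard_coe_finset]
        simp
lemma exp_neg_quarter_le : Real.exp (-(1 / 4)) ≤ 0.7805 := by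
  have h := Real.quadratic_le_exp_of_nonneg (x := 1 / 4) (by norm_num)
  rw [Real.exp_neg]
  refine inv_le_of_inv_le₀ (by norm_num) (le_trans (by norm_num) h)

lemma exp_fifth_le : Real.exp (1 / 5) ≤ 5 / 4 := by
  have h := Real.add_one_le_exp (-(1 / 5))
  rw [Real.exp_neg] at h
  have h' := (le_inv_comm₀ (by norm_num) (Real.exp_pos _)).1 h
  exact h'.trans (by norm_num)

/-- The probability that a fixed small labelled set is an obstruction. -/
lemma plantedMeasure_isObstruction_le {n : ℕ} (hn : 3 ∣ n) {p : ℝ} (h0 : 0 ≤ p) (h1 : p ≤ 1)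
    (S : Finset (Fin n)) (i : Fin n → Fin 3) (hS : (S.card : ℝ) ≤ n / 200) :
    plantedMeasure n p {ω | IsObstruction n (plantedGraph n ω) (n * p) S i} ≤
      ENNReal.ofReal (Real.exp (-(n * p * S.card / 200))) := by
  classical
  set A : ℝ := ((S.filter fun v => i v = plantedColoring n v).card : ℝ) with hA
  set B : ℝ := ((S.filter fun v => i v ≠ plantedColoring n v).card : ℝ) with hB
  have hAB : A + B = S.card := by
    rw [hA, hB]
    exact_mod_cast Finset.card_filter_add_card_filter_not (s := S)
      (fun v => i v = plantedColoring n v)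
  have hA0 : 0 ≤ A := Nat.cast_nonneg _
  have hB0 : 0 ≤ B := Nat.cast_nonneg _
  set t : BichromPair n → ℝ := fun e =>
    (if e ∈ innerPairs n S then 1 / 5 else 0) + (if e ∈ outerPairs n S i then -(1 / 4) else 0)
    with ht
  have hsub : {ω | IsObstruction n (plantedGraph n ω) (n * p) S i} ⊆
      {ω | A * (n * p / 100) - B * (n * p / 16) ≤ ∑ e, if ω e = true then t e else 0} := by
    intro ω hω
    have hsum : (∑ e, if ω e = true then t e else 0) =
        ((innerPairs n S).filter fun e => ω e = true).card * (1 / 5) +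
        ((outerPairs n S i).filter fun e => ω e = true).card * (-(1 / 4)) := by
      rw [← Finset.sum_filter, ht, Finset.sum_add_distrib, ← Finset.sum_filter,
        ← Finset.sum_filter, Finset.sum_const, Finset.sum_const, nsmul_eq_mul, nsmul_eq_mul]
      congr! 4 <;> ext e <;> simp [and_comm]
    have hin : A * (n * p / 20) ≤ ((innerPairs n S).filter fun e => ω e = true).card :=
      hω.2.trans (Nat.cast_le.2 (edgeCount_plantedGraph_le n ω S))
    have hout : (((outerPairs n S i).filter fun e => ω e = true).card : ℝ) ≤ B * (n * p / 4) := by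
      refine (Nat.cast_le.2 (card_filter_outerPairs_le n ω S i)).trans ?_
      rw [Nat.cast_sum, hB, ← nsmul_eq_mul]
      refine Finset.sum_le_card_nsmul _ _ _ fun v hv => ?_
      rw [Finset.mem_filter] at hv
      exact (hω.1 v hv.1 hv.2).le
    rw [Set.mem_ofPred_eq, hsum]
    linarith
  refine (measure_mono hsub).trans ((plantedMeasure_weighted_sum_ge_le n h0 h1 t _).trans
    (ENNReal.ofReal_le_ofReal (Real.exp_le_exp.2 ?_)))
  have hexp : ∑ e, (Real.exp (t e) - 1) =
      (innerPairs n S).card * (Real.exp (1 / 5) - 1) +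
      (outerPairs n S i).card * (Real.exp (-(1 / 4)) - 1) := by
    have hpt (e : BichromPair n) : Real.exp (t e) - 1 =
        (if e ∈ innerPairs n S then Real.exp (1 / 5) - 1 else 0) +
        (if e ∈ outerPairs n S i then Real.exp (-(1 / 4)) - 1 else 0) := by
      have hdisj : e ∈ innerPairs n S → e ∉ outerPairs n S i :=
        fun he => Finset.disjoint_left.1 (disjoint_innerPairs_outerPairs n S i) he
      by_cases he : e ∈ innerPairs n S
      · simp [ht, he, hdisj he]
      · by_cases he' : e ∈ outerPairs n S i <;> simp [ht, he, he']
    simp only [hpt]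
    rw [Finset.sum_add_distrib, ← Finset.sum_filter, ← Finset.sum_filter, Finset.sum_const,
      Finset.sum_const, nsmul_eq_mul, nsmul_eq_mul, Finset.filter_univ_mem, Finset.filter_univ_mem]
  rw [hexp]
  set k : ℝ := (S.card : ℝ) with hk
  have hk0 : 0 ≤ k := Nat.cast_nonneg _
  have hinner : ((innerPairs n S).card : ℝ) * (Real.exp (1 / 5) - 1) ≤ k ^ 2 * (1 / 4) := by
    have hcard : ((innerPairs n S).card : ℝ) ≤ k ^ 2 := by
      rw [hk]
      exact_mod_cast card_innerPairs_le n S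
    have := Real.add_one_le_exp (1 / 5 : ℝ)
    exact mul_le_mul hcard (by linarith [exp_fifth_le]) (by linarith) (by positivity)
  have hinner' : k ^ 2 * (1 / 4) ≤ n * k / 800 := by nlinarith
  have houter : ((outerPairs n S i).card : ℝ) * (Real.exp (-(1 / 4)) - 1) ≤
      -(B * n * 0.072) := by
    have hcard : B * (n / 3 - k) ≤ (outerPairs n S i).card := le_card_outerPairs hn S i
    have hcard' : B * (n * (1 / 3 - 1 / 200)) ≤ B * (n / 3 - k) :=
      mul_le_mul_of_nonneg_left (by linarith) hB0
    have hBn : 0 ≤ B * n := by positivity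
    nlinarith [exp_neg_quarter_le]
  have htotal : p * (((innerPairs n S).card : ℝ) * (Real.exp (1 / 5) - 1) +
      ((outerPairs n S i).card : ℝ) * (Real.exp (-(1 / 4)) - 1)) ≤
      p * (n * k / 800 + -(B * n * 0.072)) :=
    mul_le_mul_of_nonneg_left (by linarith) h0
  have hAp : 0 ≤ n * p * A := by positivity
  have hBp : 0 ≤ n * p * B := by positivity
  rw [← hAB] at htotal ⊢
  nlinarith

lemma choose_le_exp_mul_div_pow (n k : ℕ) :
    (n.choose k : ℝ) ≤ (Real.exp 1 * n / k) ^ k := by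
  rcases Nat.eq_zero_or_pos k with rfl | hk
  · simp
  have hk' : (0 : ℝ) < k := Nat.cast_pos.2 hk
  have hfac := Real.pow_div_factorial_le_exp (k : ℝ) hk'.le k
  have hfpos : (0 : ℝ) < k.factorial := Nat.cast_pos.2 k.factorial_pos
  refine (Nat.choose_le_pow_div k n).trans ?_
  rw [div_pow, mul_pow, ← Real.exp_nat_mul, mul_one, div_le_div_iff₀ hfpos (by positivity)]
  rw [div_le_iff₀ hfpos] at hfac
  nlinarith [pow_nonneg (Nat.cast_nonneg (α := ℝ) n) k]

/-- The probability that some set of size `k` is an obstruction. -/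
lemma plantedMeasure_exists_isObstruction_le {n : ℕ} (hn : 3 ∣ n) {p : ℝ} (h0 : 0 ≤ p)
    (h1 : p ≤ 1) {k : ℕ} (hk : (k : ℝ) ≤ n / 200) :
    plantedMeasure n p {ω | ∃ S : Finset (Fin n), ∃ i, S.card = k ∧
        IsObstruction n (plantedGraph n ω) (n * p) S i} ≤
      ENNReal.ofReal (n.choose k * 3 ^ k * Real.exp (-(n * p * k / 200))) := by
  classical
  set extend : (S : Finset (Fin n)) → (S → Fin 3) → Fin n → Fin 3 :=
    fun S j v => if h : v ∈ S then j ⟨v, h⟩ else 0 with hextend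
  have hsub : {ω | ∃ S : Finset (Fin n), ∃ i, S.card = k ∧
        IsObstruction n (plantedGraph n ω) (n * p) S i} ⊆
      ⋃ S ∈ Finset.powersetCard k (Finset.univ : Finset (Fin n)), ⋃ j : S → Fin 3,
        {ω | IsObstruction n (plantedGraph n ω) (n * p) S (extend S j)} := by
    rintro ω ⟨S, i, hcard, hS⟩
    refine Set.mem_biUnion (Finset.mem_powersetCard.2 ⟨Finset.subset_univ S, hcard⟩)
      (Set.mem_iUnion.2 ⟨fun v => i v, ?_⟩)
    exact hS.congr fun v hv => by simp [hextend, hv]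
  refine (measure_mono hsub).trans ((measure_biUnion_finset_le _ _).trans ?_)
  calc _ ≤ ∑ S ∈ Finset.powersetCard k (Finset.univ : Finset (Fin n)), ∑ _j : S → Fin 3,
        ENNReal.ofReal (Real.exp (-(n * p * k / 200))) := by
        refine Finset.sum_le_sum fun S hS => (measure_iUnion_fintype_le _ _).trans
          (Finset.sum_le_sum fun j _ => ?_)
        have hcard := (Finset.mem_powersetCard.1 hS).2
        rw [← hcard] at hk ⊢
        exact plantedMeasure_isObstruction_le hn h0 h1 S _ hk
    _ = ∑ S ∈ Finset.powersetCard k (Finset.univ : Finset (Fin n)),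
        3 ^ k * ENNReal.ofReal (Real.exp (-(n * p * k / 200))) := by
        refine Finset.sum_congr rfl fun S hS => ?_
        rw [Finset.sum_const, Finset.card_univ, Fintype.card_fun, Fintype.card_coe,
          (Finset.mem_powersetCard.1 hS).2, nsmul_eq_mul]
        simp
    _ = _ := by
        rw [Finset.sum_const, Finset.card_powersetCard, Finset.card_univ, Fintype.card_fin,
          nsmul_eq_mul, ENNReal.ofReal_mul (by positivity), ENNReal.ofReal_mul (by positivity),
          ENNReal.ofReal_natCast, ENNReal.ofReal_pow (by norm_num), ENNReal.ofReal_ofNat,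
          mul_assoc (n.choose k : ENNReal)]

/-- The union bound over sets of size `k` is polynomially small in `n` once
`k ≥ n * exp (-d / 1000)`. -/
lemma union_bound_le {n k : ℕ} {d : ℝ} (hn : 1 ≤ n) (hk : 1 ≤ k) (hd : 10 ^ 4 ≤ d)
    (hnk : Real.exp (-(d / 1000)) * n ≤ k) :
    n.choose k * 3 ^ k * Real.exp (-(d * k / 200)) ≤ Real.exp (-(Real.log n / 800)) := by
  have hk' : (1 : ℝ) ≤ k := Nat.one_le_cast.2 hk
  have hn' : (1 : ℝ) ≤ n := Nat.one_le_cast.2 hn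
  have hlog : Real.log n ≤ d / 1000 + Real.log k := by
    have h := Real.log_le_log (by positivity) hnk
    rw [Real.log_mul (Real.exp_pos _).ne' (by positivity), Real.log_exp] at h
    linarith
  have hratio : Real.exp 1 * n / k ≤ Real.exp (1 + d / 1000) := by
    rw [div_le_iff₀ (by positivity), Real.exp_add, mul_assoc]
    refine mul_le_mul_of_nonneg_left ?_ (Real.exp_pos _).le
    rw [Real.exp_neg, inv_mul_le_iff₀ (Real.exp_pos _)] at hnk
    exact hnk
  have hthree : (3 : ℝ) ≤ Real.exp 2 := by
    have := Real.add_one_le_exp (2 : ℝ)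
    linarith
  calc n.choose k * 3 ^ k * Real.exp (-(d * k / 200))
      ≤ Real.exp (1 + d / 1000) ^ k * Real.exp 2 ^ k * Real.exp (-(d * k / 200)) := by
        gcongr
        exact (choose_le_exp_mul_div_pow n k).trans (by gcongr)
    _ = Real.exp (k * (1 + d / 1000) + k * 2 + -(d * k / 200)) := by
        rw [← Real.exp_nat_mul, ← Real.exp_nat_mul, ← Real.exp_add, ← Real.exp_add]
    _ ≤ _ := by
        refine Real.exp_le_exp.2 ?_
        have hlogk := Real.log_le_sub_one_of_pos (x := (k : ℝ)) (by positivity)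
        have hdk : d ≤ d * k := le_mul_of_one_le_right (by linarith) hk'
        have hdk' : 10 ^ 4 * (k : ℝ) ≤ d * k := mul_le_mul_of_nonneg_right hd (by positivity)
        linarith

/-- whp the planted graph admits an `(np)`-core of size at least
`(1 - e^{-c n p}) n`. -/
theorem exists_large_core :
    ∃ C0 c : ℝ, 0 < C0 ∧ 0 < c ∧
      ∀ δ : ℝ, 0 < δ → ∃ N : ℕ,
        ∀ n : ℕ, N ≤ n → 3 ∣ n → ∀ p : ℝ, 0 ≤ p → p ≤ 1 → C0 ≤ n * p →
          ENNReal.ofReal (1 - δ) ≤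
            plantedMeasure n p {ω : BichromPair n → Bool |
              ∃ D : Set (Fin n), IsCore n (plantedGraph n ω) (n * p) D ∧
                (1 - Real.exp (-(c * n * p))) * n ≤ (D.ncard : ℝ)} := by
  refine ⟨10 ^ 4, 1 / 1000, by norm_num, by norm_num, fun δ hδ => ?_⟩
  obtain ⟨N, hN⟩ := exists_nat_ge (max 400 (Real.exp (-(800 * Real.log δ))))
  refine ⟨N, fun n hNn h3 p h0 h1 hd => ?_⟩
  have hn : max 400 (Real.exp (-(800 * Real.log δ))) ≤ n := hN.trans (Nat.cast_le.2 hNn)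
  have hn400 : (400 : ℝ) ≤ n := (le_max_left _ _).trans hn
  have hlogn : -(800 * Real.log δ) ≤ Real.log n :=
    (Real.le_log_iff_exp_le (by linarith)).2 ((le_max_right _ _).trans hn)
  set ε := Real.exp (-(1 / 1000 * n * p)) with hε
  have hε' : ε = Real.exp (-(n * p / 1000)) := by rw [hε]; ring_nf
  have hε400 : ε ≤ 1 / 400 := by
    have h10 : ε ≤ Real.exp (-10) := Real.exp_le_exp.2 (by linarith)
    have h2 : (2 : ℝ) ^ 10 ≤ Real.exp 1 ^ 10 :=
      pow_le_pow_left₀ (by norm_num) (by linarith [Real.add_one_le_exp (1 : ℝ)]) 10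
    rw [← Real.exp_nat_mul] at h2
    rw [Real.exp_neg] at h10
    refine h10.trans (inv_le_of_inv_le₀ (by norm_num) ?_)
    norm_num at h2 ⊢
    linarith
  have hεn : 0 ≤ ε * n := mul_nonneg (Real.exp_pos _).le (by linarith)
  set m := ⌊ε * n⌋₊ with hm
  have hmle : (m : ℝ) ≤ ε * n := Nat.floor_le hεn
  have hmlt : ε * n < (m + 1 : ℕ) := by
    push_cast
    exact Nat.lt_floor_add_one _
  have hbad := plantedMeasure_exists_isObstruction_le h3 h0 h1 (k := m + 1) (by
    push_cast
    nlinarith)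
  have hprob := isProbabilityMeasure_plantedMeasure n h0 h1
  set good := {ω : BichromPair n → Bool | ∃ D : Set (Fin n),
    IsCore n (plantedGraph n ω) (n * p) D ∧ (1 - ε) * n ≤ (D.ncard : ℝ)} with hgood
  have hcompl : goodᶜ ⊆ {ω | ∃ S : Finset (Fin n), ∃ i, S.card = m + 1 ∧
      IsObstruction n (plantedGraph n ω) (n * p) S i} := by
    intro ω hω
    refine exists_isObstruction (m := m) (fun S hS hcore => hω ⟨_, hcore, ?_⟩) (m + 1) le_rfl
    have hcard := Set.ncard_add_ncard_compl (S : Set (Fin n))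
    rw [Set.ncard_coe_finset, Nat.card_fin] at hcard
    have hcard' : (S.card : ℝ) + ((S : Set (Fin n))ᶜ.ncard : ℝ) = n := by exact_mod_cast hcard
    have hS' : (S.card : ℝ) ≤ m := Nat.cast_le.2 hS
    linarith
  have hδ' : plantedMeasure n p goodᶜ ≤ ENNReal.ofReal δ := by
    refine (measure_mono hcompl).trans (hbad.trans (ENNReal.ofReal_le_ofReal ?_))
    refine (union_bound_le (by exact_mod_cast (by linarith : (1 : ℝ) ≤ n)) (by omega) hd
      (by rw [← hε']; exact hmlt.le)).trans ?_
    rw [← Real.le_log_iff_exp_le hδ]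
    linarith
  rw [ENNReal.ofReal_sub _ hδ.le, ENNReal.ofReal_one, tsub_le_iff_right]
  calc 1 = plantedMeasure n p (good ∪ goodᶜ) := by rw [Set.union_compl_self, measure_univ]
    _ ≤ plantedMeasure n p good + plantedMeasure n p goodᶜ := measure_union_le _ _
    _ ≤ _ := by gcongr
end

section
/- Let n be divisible by 3, let G be a finite simple graph on V = Fin n for which the balanced planted coloring φ* is a proper 3-coloring, and let d ≥ 40 be a real number. Assume: (i) D ⊆ V is a d-core; (ii) there is no nonempty S ⊆ V with |S| ≤ n/60 and 2·e(S) ≥ (d/60)·|S|. Let φ : V → Fin 3 satisfy |{v : φ(v) ≠ φ*(v)}| ≤ n/120. Then for the Gallager iterates started from φ, for every natural number i with 2^i ≥ n, every v ∈ D, and every neighbor u of v, one has m^i(v→u) = some(φ*(v)), and moreover B(v, m^i) = some(φ*(v)). -/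
open MeasureTheory

theorem argminFin3_eq_of_lt {f : Fin 3 → ℕ} {a : Fin 3} (h : ∀ t, t ≠ a → f a < f t) :
    argminFin3 f = a := by
  have h0 := h 0
  have h1 := h 1
  have h2 := h 2
  unfold argminFin3
  fin_cases a <;> simp at h0 h1 h2 ⊢ <;> split_ifs <;> simp <;> omega

/-- The update sends `a` whenever `a` has the strictly smallest count. -/
theorem gallagerUpdate_eq_some_of_lt {V : Type*} {G : SimpleGraph V}
    {m : V → V → Option (Fin 3)} {u v : V} {a : Fin 3}
    (h : ∀ t, t ≠ a → msgCount G m u v a < msgCount G m u v t) :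
    gallagerUpdate G m u v = some a := by
  unfold gallagerUpdate
  rw [if_neg, argminFin3_eq_of_lt h]
  rintro ⟨t₁, t₂, hne, h₁, h₂⟩
  by_cases h1a : t₁ = a
  · have := h t₂ fun h2a => hne (h1a.trans h2a.symm)
    omega
  · have := h t₁ h1a
    omega

theorem outCount_eq_msgCount_self {V : Type*} (G : SimpleGraph V)
    (m : V → V → Option (Fin 3)) (u : V) : outCount G m u = msgCount G m u u := by
  funext t
  unfold outCount msgCount
  congr 1
  ext w
  exact ⟨fun h => ⟨h.1, h.1.ne', h.2⟩, fun h => ⟨h.1, h.2.2⟩⟩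

theorem gallagerOutput_eq_gallagerUpdate_self {V : Type*} (G : SimpleGraph V)
    (m : V → V → Option (Fin 3)) (u : V) : gallagerOutput G m u = gallagerUpdate G m u u := by
  unfold gallagerOutput gallagerUpdate
  rw [outCount_eq_msgCount_self]

/-- Summing over `B` the degrees into `A` counts each edge inside `S ⊇ A ∪ B` at most twice. -/
theorem sum_ncard_neighbors_le_two_mul_edgeCount {V : Type*} [Finite V] (G : SimpleGraph V)
    {A : Set V} {B : Finset V} {S : Set V} (hA : A ⊆ S) (hB : (B : Set V) ⊆ S) :
    ∑ v ∈ B, {w | G.Adj v w ∧ w ∈ A}.ncard ≤ 2 * edgeCount G S := by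
  classical
  have := Fintype.ofFinite V
  have hpairs : ∑ v ∈ B, {w | G.Adj v w ∧ w ∈ A}.ncard =
      (B.sigma fun v => Finset.univ.filter fun w => G.Adj v w ∧ w ∈ A).card := by
    rw [Finset.card_sigma]
    refine Finset.sum_congr rfl fun v _ => ?_
    rw [← Set.ncard_coe_finset]
    simp
  have hedges : edgeCount G S =
      (Finset.univ.filter fun e : Sym2 V => e ∈ G.edgeSet ∧ ∀ v ∈ e, v ∈ S).card := by
    unfold edgeCount
    rw [← Set.ncard_coe_finset]
    simp
  rw [hpairs, hedges]
  refine Finset.card_le_mul_card_image_of_maps_to (f := fun p : Σ _ : V, V => s(p.1, p.2)) ?_ 2 ?_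
  · rintro ⟨v, w⟩ hp
    simp only [Finset.mem_sigma, Finset.mem_filter, Finset.mem_univ, true_and] at hp ⊢
    obtain ⟨hv, hvw, hw⟩ := hp
    refine ⟨hvw, fun x hx => ?_⟩
    rcases Sym2.mem_iff.1 hx with rfl | rfl
    exacts [hB hv, hA hw]
  · intro e _
    induction e using Sym2.ind with
    | _ a b =>
      refine (Finset.card_le_card (t := {⟨a, b⟩, ⟨b, a⟩}) ?_).trans Finset.card_le_two
      rintro ⟨v, w⟩ hp
      have hvw := Sym2.eq_iff.1 (Finset.mem_filter.1 hp).2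
      rcases hvw with ⟨rfl, rfl⟩ | ⟨rfl, rfl⟩ <;> simp

/-- The vertices of `D` that send some message other than their planted color. -/
def wrongSenders {n : ℕ} (G : SimpleGraph (Fin n)) (D : Set (Fin n))
    (m : Fin n → Fin n → Option (Fin 3)) : Set (Fin n) :=
  {v | v ∈ D ∧ ∃ u, G.Adj v u ∧ m v u ≠ some (plantedColoring n v)}

section Core

variable {n : ℕ} {G : SimpleGraph (Fin n)} {d : ℝ} {D : Set (Fin n)}

/-- A core vertex with few wrong senders among its neighbors sends its planted color. -/
theorem IsCore.gallagerUpdate_eq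
    (hproper : ∀ u v : Fin n, G.Adj u v → plantedColoring n u ≠ plantedColoring n v)
    (hd : 40 ≤ d) (hD : IsCore n G d D) {m : Fin n → Fin n → Option (Fin 3)}
    {v : Fin n} (hv : v ∈ D) (u : Fin n)
    (hfew : ({w | G.Adj v w ∧ w ∈ wrongSenders G D m}.ncard : ℝ) < d / 16) :
    gallagerUpdate G m v u = some (plantedColoring n v) := by
  have hmsg : ∀ w, G.Adj v w → w ∈ D → w ∉ wrongSenders G D m →
      m w v = some (plantedColoring n w) := fun w hvw hw hnot => by
    by_contra hne
    exact hnot ⟨hw, v, hvw.symm, hne⟩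
  refine gallagerUpdate_eq_some_of_lt fun t ht => ?_
  have hupper : msgCount G m v u (plantedColoring n v) ≤
      {w | G.Adj v w ∧ w ∉ D}.ncard + {w | G.Adj v w ∧ w ∈ wrongSenders G D m}.ncard := by
    refine (Set.ncard_le_ncard ?_ (Set.toFinite _)).trans (Set.ncard_union_le _ _)
    rintro w ⟨hvw, -, hw⟩
    by_contra hnot
    simp only [Set.mem_union, Set.mem_ofPred_eq, hvw, true_and, not_or, not_not] at hnot
    rw [hmsg w hvw hnot.1 hnot.2] at hw
    exact hproper v w hvw (Option.some_injective _ hw).symm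
  have hlower : {w | G.Adj v w ∧ w ∈ D ∧ plantedColoring n w = t}.ncard ≤
      msgCount G m v u t + {w | G.Adj v w ∧ w ∈ wrongSenders G D m}.ncard + 1 := by
    rw [← Set.ncard_singleton u]
    refine (Set.ncard_le_ncard ?_ (Set.toFinite _)).trans
      ((Set.ncard_union_le _ _).trans (Nat.add_le_add_right (Set.ncard_union_le _ _) _))
    rintro w ⟨hvw, hw, rfl⟩
    by_cases hwu : w = u
    · exact Or.inr hwu
    by_cases hwrong : w ∈ wrongSenders G D m
    · exact Or.inl (Or.inr ⟨hvw, hwrong⟩)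
    · exact Or.inl (Or.inl ⟨hvw, hwu, hmsg w hvw hw hwrong⟩)
  have hin := (hD v hv).1 t ht
  have hout := (hD v hv).2
  have hupper' : (msgCount G m v u (plantedColoring n v) : ℝ) ≤ _ := Nat.cast_le.2 hupper
  have hlower' : (_ : ℝ) ≤ _ := Nat.cast_le.2 hlower
  push_cast at hupper' hlower'
  have : (msgCount G m v u (plantedColoring n v) : ℝ) < msgCount G m v u t := by linarith
  exact_mod_cast this

/-- Without small dense subgraphs, an update at least halves a small set of wrong senders. -/
theorem IsCore.two_mul_ncard_wrongSenders_gallagerUpdate_le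
    (hproper : ∀ u v : Fin n, G.Adj u v → plantedColoring n u ≠ plantedColoring n v)
    (hd : 40 ≤ d) (hD : IsCore n G d D)
    (hdense : ¬ ∃ S : Set (Fin n), S.Nonempty ∧ (S.ncard : ℝ) ≤ (n : ℝ) / 60 ∧
      (d / 60) * (S.ncard : ℝ) ≤ 2 * (edgeCount G S : ℝ))
    {m : Fin n → Fin n → Option (Fin 3)}
    (hsmall : ((wrongSenders G D m).ncard : ℝ) ≤ (n : ℝ) / 120) :
    2 * (wrongSenders G D (gallagerUpdate G m)).ncard ≤ (wrongSenders G D m).ncard := by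
  classical
  have hmany : ∀ v ∈ wrongSenders G D (gallagerUpdate G m),
      d / 16 ≤ ({w | G.Adj v w ∧ w ∈ wrongSenders G D m}.ncard : ℝ) := by
    rintro v ⟨hv, u, -, hne⟩
    by_contra! hfew
    exact hne (hD.gallagerUpdate_eq hproper hd hv u hfew)
  set A := wrongSenders G D m
  set A' := wrongSenders G D (gallagerUpdate G m)
  by_contra! hlt
  have hApos : 0 < A.ncard := by
    obtain ⟨v, hv⟩ := Set.nonempty_of_ncard_ne_zero (s := A') (by omega)
    have hpos : (0 : ℝ) < ({w | G.Adj v w ∧ w ∈ A}.ncard : ℝ) := by linarith [hmany v hv]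
    exact (Nat.cast_pos.1 hpos).trans_le (Set.ncard_le_ncard (fun w hw => hw.2) (Set.toFinite _))
  obtain ⟨B, hBA', hBcard⟩ := Set.exists_subset_card_eq (s := A') (min_le_left A'.ncard A.ncard)
  have hcard : (A ∪ B).ncard ≤ A.ncard + B.ncard := Set.ncard_union_le _ _
  have hcard' : ((A ∪ B).ncard : ℝ) ≤ A.ncard + B.ncard := by exact_mod_cast hcard
  have hBle : (B.ncard : ℝ) ≤ A.ncard := by
    exact_mod_cast hBcard.trans_le (min_le_right _ _)
  have hleB : (A.ncard : ℝ) ≤ 2 * B.ncard := by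
    have : A.ncard ≤ 2 * B.ncard := by omega
    exact_mod_cast this
  refine hdense ⟨A ∪ B, ((Set.ncard_pos (Set.toFinite _)).1 hApos).inl, by linarith, ?_⟩
  have hsum := sum_ncard_neighbors_le_two_mul_edgeCount G (B := B.toFinset)
    (Set.subset_union_left : A ⊆ A ∪ B) (by simp)
  have hsum' : (_ : ℝ) ≤ _ := Nat.cast_le.2 hsum
  push_cast at hsum'
  refine le_trans ?_ hsum'
  have hdeg := Finset.card_nsmul_le_sum B.toFinset
    (fun v => ({w | G.Adj v w ∧ w ∈ A}.ncard : ℝ)) (d / 16)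
    fun v hv => hmany v (hBA' (Set.mem_toFinset.1 hv))
  rw [nsmul_eq_mul, ← Set.ncard_eq_toFinset_card'] at hdeg
  refine le_trans ?_ hdeg
  nlinarith [(Nat.cast_nonneg B.ncard : (0 : ℝ) ≤ B.ncard)]

end Core

/-- deterministic convergence on the core. If `D` is a `d`-core, there is no
small dense subgraph, and the initial coloring differs from the planted one on at most
`n/120` vertices, then after `i` iterations with `2^i ≥ n` all messages leaving core
vertices, as well as the outputs at core vertices, equal the planted color. -/
theorem core_messages_converge (n : ℕ) (hn : 3 ∣ n) (G : SimpleGraph (Fin n))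
    (hproper : ∀ u v : Fin n, G.Adj u v → plantedColoring n u ≠ plantedColoring n v)
    (d : ℝ) (hd : 40 ≤ d) (D : Set (Fin n)) (hD : IsCore n G d D)
    (hdense : ¬ ∃ S : Set (Fin n), S.Nonempty ∧ (S.ncard : ℝ) ≤ (n : ℝ) / 60 ∧
      (d / 60) * (S.ncard : ℝ) ≤ 2 * (edgeCount G S : ℝ))
    (φ : Fin n → Fin 3)
    (hφ : ({v : Fin n | φ v ≠ plantedColoring n v}.ncard : ℝ) ≤ (n : ℝ) / 120) :
    ∀ i : ℕ, n ≤ 2 ^ i → ∀ v ∈ D,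
      (∀ u : Fin n, G.Adj v u → gallagerIter G φ i v u = some (plantedColoring n v)) ∧
      gallagerOutput G (gallagerIter G φ i) v = some (plantedColoring n v) := by
  have hcontract : ∀ i, 2 ^ i * (wrongSenders G D (gallagerIter G φ i)).ncard ≤
      {v : Fin n | φ v ≠ plantedColoring n v}.ncard := by
    intro i
    induction i with
    | zero =>
      rw [pow_zero, one_mul]
      refine Set.ncard_le_ncard ?_ (Set.toFinite _)
      rintro v ⟨-, u, -, hne⟩ heq
      exact hne (congrArg some heq)
    | succ i ih =>
      have hle := (Nat.le_mul_of_pos_left _ (Nat.two_pow_pos i)).trans ih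
      have hhalf := hD.two_mul_ncard_wrongSenders_gallagerUpdate_le hproper hd hdense
        ((Nat.cast_le.2 hle).trans hφ)
      calc 2 ^ (i + 1) * (wrongSenders G D (gallagerIter G φ (i + 1))).ncard
          = 2 ^ i * (2 * (wrongSenders G D (gallagerUpdate G (gallagerIter G φ i))).ncard) := by
            rw [pow_succ, mul_assoc]; rfl
        _ ≤ 2 ^ i * (wrongSenders G D (gallagerIter G φ i)).ncard :=
            Nat.mul_le_mul_left _ hhalf
        _ ≤ _ := ih
  intro i hi v hv
  have hempty : wrongSenders G D (gallagerIter G φ i) = ∅ := by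
    rw [← Set.ncard_eq_zero (Set.toFinite _)]
    by_contra hne
    have hle : n ≤ {v : Fin n | φ v ≠ plantedColoring n v}.ncard :=
      (hi.trans (Nat.le_mul_of_pos_right _ (Nat.pos_of_ne_zero hne))).trans (hcontract i)
    have hle' : (n : ℝ) ≤ _ := Nat.cast_le.2 hle
    have hpos : (0 : ℝ) < n := Nat.cast_pos.2 v.pos
    linarith
  constructor
  · intro u hvu
    by_contra hne
    exact hempty.le ⟨hv, u, hvu, hne⟩
  · rw [gallagerOutput_eq_gallagerUpdate_self]
    refine hD.gallagerUpdate_eq hproper hd hv v ?_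
    simp only [hempty, Set.mem_empty_iff_false, and_false, Set.ofPred_false, Set.ncard_empty,
      Nat.cast_zero]
    linarith
end

section
/- Let G be a finite simple graph on vertex set V, let φ* : V → Fin 3 be a proper 3-coloring of G, and let D ⊆ V be such that the induced subgraph G[V ∖ D] is acyclic and every connected component of G[V ∖ D] has at most M vertices. Let φ : V → Fin 3 be an initial coloring and suppose there is an iteration i0 such that for all i ≥ i0, every v ∈ D and every neighbor u of v, the Gallager iterates started from φ satisfy m^i(v→u) = some(φ*(v)). Then for every i ≥ i0 + 2M + 2: m^{i+1} = m^i; for every vertex u and every neighbor v of u, m^i(u→v) is either some(φ*(u)) or none; and for every vertex u, B(u, m^i) is either some(φ*(u)) or none. -/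
open MeasureTheory

/-- If only `c` can have count `0`, the smallest minimizer is `c`. -/
lemma argminFin3_eq_of_eq_zero {f : Fin 3 → ℕ} {c : Fin 3} (hc : f c = 0)
    (h : ∀ t, t ≠ c → f t ≠ 0) : argminFin3 f = c := by
  have h0 := h 0
  have h1 := h 1
  have h2 := h 2
  unfold argminFin3
  fin_cases c <;> simp_all

open Classical in
/-- A decision rule that sees no vote for `c` returns either `c` or Undecided. -/
lemma decision_eq_some_or_none {f : Fin 3 → ℕ} {c : Fin 3} (hc : f c = 0) :
    (if ∃ t₁ t₂ : Fin 3, t₁ ≠ t₂ ∧ f t₁ = 0 ∧ f t₂ = 0 then none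
      else some (argminFin3 f)) = some c ∨
    (if ∃ t₁ t₂ : Fin 3, t₁ ≠ t₂ ∧ f t₁ = 0 ∧ f t₂ = 0 then none
      else some (argminFin3 f)) = none := by
  split_ifs with h
  · exact Or.inr rfl
  · exact Or.inl (congrArg some (argminFin3_eq_of_eq_zero hc
      fun t ht h0 => h ⟨t, c, ht, h0, hc⟩))

section Messages

variable {V : Type*} {G : SimpleGraph V} {φstar : V → Fin 3}

lemma gallagerUpdate_eq_some_or_none (hproper : ∀ u v : V, G.Adj u v → φstar u ≠ φstar v)
    {m : V → V → Option (Fin 3)} {u v : V}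
    (hm : ∀ w, G.Adj u w → w ≠ v → m w u = some (φstar w) ∨ m w u = none) :
    gallagerUpdate G m u v = some (φstar u) ∨ gallagerUpdate G m u v = none := by
  refine decision_eq_some_or_none ?_
  have : {w : V | G.Adj u w ∧ w ≠ v ∧ m w u = some (φstar u)} = ∅ := by
    ext w
    have := hproper u w
    have := hm w
    grind
  rw [msgCount, this, Set.ncard_empty]

lemma gallagerOutput_eq_some_or_none (hproper : ∀ u v : V, G.Adj u v → φstar u ≠ φstar v)
    {m : V → V → Option (Fin 3)} {u : V}
    (hm : ∀ w, G.Adj u w → m w u = some (φstar w) ∨ m w u = none) :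
    gallagerOutput G m u = some (φstar u) ∨ gallagerOutput G m u = none := by
  refine decision_eq_some_or_none ?_
  have : {w : V | G.Adj u w ∧ m w u = some (φstar u)} = ∅ := by
    ext w
    have := hproper u w
    have := hm w
    grind
  rw [outCount, this, Set.ncard_empty]

lemma gallagerUpdate_congr {m m' : V → V → Option (Fin 3)} {u v : V}
    (h : ∀ w, G.Adj u w → w ≠ v → m w u = m' w u) :
    gallagerUpdate G m u v = gallagerUpdate G m' u v := by
  have : msgCount G m u v = msgCount G m' u v := by
    funext t
    unfold msgCount
    congr 1
    ext w
    have := h w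
    grind
  simp only [gallagerUpdate, this]

end Messages

/-- In an acyclic graph, a path starting at a neighbor `w` of `u` and avoiding `u` meets no
neighbor of `u` other than `w`. -/
lemma SimpleGraph.IsAcyclic.eq_of_adj_of_mem_support {W : Type*} {H : SimpleGraph W}
    (hH : H.IsAcyclic) {u v w x : W} (huw : H.Adj u w) (huv : H.Adj u v) {p : H.Walk w x}
    (hp : p.IsPath) (hu : u ∉ p.support) (hv : v ∈ p.support) : v = w := by
  classical
  have hq : (Walk.cons huw (p.takeUntil v hv)).IsPath :=
    (hp.takeUntil hv).cons fun h => hu (p.support_takeUntil_subset_support hv h)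
  have he : (Walk.cons huv Walk.nil).IsPath := Walk.IsPath.nil.cons (by simpa using huv.ne)
  have h := congrArg (fun q : H.Path u v => q.1.length)
    ((hH.subsingleton_path u v).elim ⟨_, hq⟩ ⟨_, he⟩)
  simp only [Walk.length_cons, Walk.length_nil] at h
  exact (Walk.eq_of_length_eq_zero (p := p.takeUntil v hv) (by omega)).symm

/-- A path has fewer edges than its component has vertices. -/
lemma SimpleGraph.Walk.IsPath.length_lt_ncard_supp {W : Type*} [Finite W] {H : SimpleGraph W}
    {u v : W} {p : H.Walk u v} (hp : p.IsPath) :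
    p.length < (H.connectedComponentMk u).supp.ncard := by
  classical
  have hsub : (p.support.toFinset : Set W) ⊆ (H.connectedComponentMk u).supp := by
    intro y hy
    have hy : y ∈ p.support := by simpa using hy
    exact ConnectedComponent.sound (p.takeUntil y hy).reachable.symm
  have := Set.ncard_le_ncard hsub (Set.toFinite _)
  rw [Set.ncard_coe_finset, List.toFinset_card_of_nodup hp.support_nodup,
    Walk.length_support] at this
  omega

/-- If no path of length `n` outside `D` starts at `u` and avoids `v`, then from iteration
`i0 + n` on the message `u → v` is constant and never a wrong color. -/
lemma gallagerIter_stable_of_no_path {V : Type*} {G : SimpleGraph V} {φstar : V → Fin 3}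
    (hproper : ∀ u v : V, G.Adj u v → φstar u ≠ φstar v) {D : Set V}
    (hacyc : (SimpleGraph.induce Dᶜ G).IsAcyclic) {φ : V → Fin 3} {i0 : ℕ}
    (hcore : ∀ i : ℕ, i0 ≤ i → ∀ v ∈ D, ∀ u : V, G.Adj v u →
      gallagerIter G φ i v u = some (φstar v)) (n : ℕ) :
    ∀ (u : ↥Dᶜ) (v : V), G.Adj u v →
      (∀ (x : ↥Dᶜ) (p : (SimpleGraph.induce Dᶜ G).Walk u x), p.IsPath → p.length = n →
        ∃ y ∈ p.support, (y : V) = v) →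
      ∀ i, i0 + n ≤ i → gallagerIter G φ (i + 1) u v = gallagerIter G φ i u v ∧
        (gallagerIter G φ i u v = some (φstar u) ∨ gallagerIter G φ i u v = none) := by
  induction n with
  | zero =>
    intro u v huv h
    obtain ⟨y, hy, rfl⟩ := h u .nil .nil rfl
    obtain rfl : y = u := by simpa using hy
    exact absurd huv G.irrefl
  | succ n ih =>
    intro u v huv h i hi
    obtain ⟨j, rfl⟩ : ∃ j, i = j + 1 := ⟨i - 1, by omega⟩
    have key : ∀ w, G.Adj u w → w ≠ v →
        gallagerIter G φ (j + 1) w u = gallagerIter G φ j w u ∧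
          (gallagerIter G φ j w u = some (φstar w) ∨ gallagerIter G φ j w u = none) := by
      intro w huw hwv
      by_cases hw : w ∈ D
      · rw [hcore _ (by omega) w hw u huw.symm, hcore _ (by omega) w hw u huw.symm]
        exact ⟨rfl, Or.inl rfl⟩
      · refine ih ⟨w, hw⟩ u huw.symm (fun x p hp hlen => ?_) j (by omega)
        by_contra hu
        have hup : u ∉ p.support := fun hmem => hu ⟨u, hmem, rfl⟩
        have huw' : (SimpleGraph.induce Dᶜ G).Adj u ⟨w, hw⟩ := huw
        obtain ⟨y, hy, rfl⟩ := h x (.cons huw' p) (hp.cons hup) (by simp [hlen])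
        rw [SimpleGraph.Walk.support_cons, List.mem_cons] at hy
        rcases hy with rfl | hy
        · exact G.irrefl huv
        · exact hwv (congrArg Subtype.val
            (hacyc.eq_of_adj_of_mem_support huw' huv hp hup hy)).symm
    exact ⟨gallagerUpdate_congr fun w hw hwv => (key w hw hwv).1,
      gallagerUpdate_eq_some_or_none hproper fun w hw hwv => (key w hw hwv).2⟩

/-- convergence outside the core. If the complement of `D` induces a forest
with components of at most `M` vertices and from iteration `i0` on all messages leaving `D`
state the planted color, then after `i0 + 2M + 2` iterations the process has converged and
every message/output is either the planted color or Undecided. -/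
theorem noncore_messages_converge {V : Type*} [Fintype V] [DecidableEq V]
    (G : SimpleGraph V) (φstar : V → Fin 3)
    (hproper : ∀ u v : V, G.Adj u v → φstar u ≠ φstar v)
    (D : Set V) (M : ℕ)
    (hacyc : (SimpleGraph.induce Dᶜ G).IsAcyclic)
    (hcomp : ∀ comp : (SimpleGraph.induce Dᶜ G).ConnectedComponent, comp.supp.ncard ≤ M)
    (φ : V → Fin 3) (i0 : ℕ)
    (hcore : ∀ i : ℕ, i0 ≤ i → ∀ v ∈ D, ∀ u : V, G.Adj v u →
      gallagerIter G φ i v u = some (φstar v)) :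
    ∀ i : ℕ, i0 + 2 * M + 2 ≤ i →
      (∀ u v : V, G.Adj u v → gallagerIter G φ (i + 1) u v = gallagerIter G φ i u v) ∧
      (∀ u v : V, G.Adj u v →
        gallagerIter G φ i u v = some (φstar u) ∨ gallagerIter G φ i u v = none) ∧
      (∀ u : V, gallagerOutput G (gallagerIter G φ i) u = some (φstar u) ∨
        gallagerOutput G (gallagerIter G φ i) u = none) := by
  have key : ∀ i, i0 + M ≤ i → ∀ u v : V, G.Adj u v →
      gallagerIter G φ (i + 1) u v = gallagerIter G φ i u v ∧
        (gallagerIter G φ i u v = some (φstar u) ∨ gallagerIter G φ i u v = none) := by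
    intro i hi u v huv
    by_cases hu : u ∈ D
    · rw [hcore _ (by omega) u hu v huv, hcore _ (by omega) u hu v huv]
      exact ⟨rfl, Or.inl rfl⟩
    · refine gallagerIter_stable_of_no_path hproper hacyc hcore M ⟨u, hu⟩ v huv
        (fun x p hp hlen => absurd hp.length_lt_ncard_supp ?_) i hi
      exact not_lt.mpr (hlen ▸ hcomp _)
  intro i hi
  have hi' : i0 + M ≤ i := by omega
  exact ⟨fun u v huv => (key i hi' u v huv).1, fun u v huv => (key i hi' u v huv).2,
    fun u => gallagerOutput_eq_some_or_none hproper fun w hw => (key i hi' w u hw.symm).2⟩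
end
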